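/- For each real number p ∈ (1, ∞) with p ≠ 2 there exists a real Banach space X isomorphic (linearly homeomorphic) to ℓ_p such that J(X) = J(ℓ_p), where J denotes the James constant, but the supremum in the definition of J(X) is not attained: for all x, y in the unit sphere of X, min(‖x+y‖, ‖x−y‖) < J(X). -/

import Mathlib

open scoped ENNReal

/-- The James constant of a normed space:
`J(X) = sup { min (‖x+y‖, ‖x-y‖) : x, y ∈ S_X }`. -/
noncomputable def jamesConstant (X : Type*) [SeminormedAddCommGroup X] : ℝ :=
  sSup {r : ℝ | ∃ x y : X, ‖x‖ = 1 ∧ ‖y‖ = 1 ∧ r = min ‖x + y‖ ‖x - y‖}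

section RealInequalities

open Real in
lemma add_rpow_lt {r s t : ℝ} (hr : 1 < r) (hs : 0 < s) (ht : 0 < t) :
    s ^ r + t ^ r < (s + t) ^ r := by
  have key : ∀ x : ℝ, 0 < x → x ^ r = x * x ^ (r - 1) := fun x hx => by
    rw [rpow_sub_one hx.ne']; field_simp
  rw [key _ hs, key _ ht, key _ (add_pos hs ht), add_mul]
  have h0 : 0 < r - 1 := by linarith
  gcongr <;> linarith

open Real in
lemma lt_add_rpow {r s t : ℝ} (hr : r < 1) (hs : 0 < s) (ht : 0 < t) :
    (s + t) ^ r < s ^ r + t ^ r := by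
  have key : ∀ x : ℝ, 0 < x → x ^ r = x * x ^ (r - 1) := fun x hx => by
    rw [rpow_sub_one hx.ne']; field_simp
  rw [key _ hs, key _ ht, key _ (add_pos hs ht), add_mul]
  have h0 : r - 1 < 0 := by linarith
  have h1 := rpow_lt_rpow_of_neg hs (show s < s + t by linarith) h0
  have h2 := rpow_lt_rpow_of_neg ht (show t < s + t by linarith) h0
  gcongr

open Real in
lemma add_rpow_le_of_le_one {r s t : ℝ} (hr : 0 ≤ r) (hr1 : r ≤ 1) (hs : 0 ≤ s) (ht : 0 ≤ t) :
    s ^ r + t ^ r ≤ 2 * ((s + t) / 2) ^ r := by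
  have := (concaveOn_rpow hr hr1).2 (Set.mem_Ici.2 hs) (Set.mem_Ici.2 ht)
    (by norm_num : (0 : ℝ) ≤ 1 / 2) (by norm_num : (0 : ℝ) ≤ 1 / 2) (by norm_num)
  simp only [smul_eq_mul] at this
  rw [show (s + t) / 2 = 1 / 2 * s + 1 / 2 * t by ring]
  linarith

open Real in
lemma two_mul_rpow_le_of_one_le {r a b : ℝ} (hr : 1 ≤ r) (ha : 0 ≤ a) (hb : 0 ≤ b) :
    2 * ((a + b) / 2) ^ r ≤ a ^ r + b ^ r := by
  have := (convexOn_rpow hr).2 (Set.mem_Ici.2 ha) (Set.mem_Ici.2 hb)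
    (by norm_num : (0 : ℝ) ≤ 1 / 2) (by norm_num : (0 : ℝ) ≤ 1 / 2) (by norm_num)
  simp only [smul_eq_mul] at this
  rw [show (a + b) / 2 = 1 / 2 * a + 1 / 2 * b by ring]
  linarith

/-- The constant `max (2, 2 ^ (p - 1))`, which is the `p`-th power of the James constant of
`ℓ_p`. -/
noncomputable def clarksonConst (p : ℝ) : ℝ := max 2 (2 ^ (p - 1))

lemma clarksonConst_pos (p : ℝ) : 0 < clarksonConst p :=
  lt_of_lt_of_le two_pos (le_max_left _ _)

lemma clarksonConst_of_le_two {p : ℝ} (hp : p ≤ 2) : clarksonConst p = 2 := by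
  refine max_eq_left ?_
  calc (2 : ℝ) ^ (p - 1) ≤ 2 ^ (1 : ℝ) :=
        Real.rpow_le_rpow_of_exponent_le one_le_two (by linarith)
    _ = 2 := Real.rpow_one 2

lemma clarksonConst_of_two_le {p : ℝ} (hp : 2 ≤ p) : clarksonConst p = 2 ^ (p - 1) := by
  refine max_eq_right ?_
  calc (2 : ℝ) = 2 ^ (1 : ℝ) := (Real.rpow_one 2).symm
    _ ≤ 2 ^ (p - 1) := Real.rpow_le_rpow_of_exponent_le one_le_two (by linarith)

/-- `2 * (x / 2) ^ r` in terms of `x ^ r`, in the form used for exponents `p = 2 * r`. -/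
lemma two_mul_rpow_add {p c : ℝ} (hc : 0 ≤ c) :
    (2 * c) ^ (p / 2) = 2 ^ (p - 1) * (2 * (c / 2) ^ (p / 2)) := by
  have h4 : (2 : ℝ) ^ (p - 1) * 2 = 4 ^ (p / 2) := by
    rw [Real.rpow_sub_one two_ne_zero, div_mul_cancel₀ _ two_ne_zero,
      show (4 : ℝ) = 2 ^ (2 : ℝ) by norm_num, ← Real.rpow_mul two_pos.le]
    congr 1
    ring
  rw [← mul_assoc, h4, ← Real.mul_rpow (by norm_num) (by positivity)]
  congr 1
  ring

lemma rpow_half_add_le {p a b s t : ℝ} (hp : 0 ≤ p) (ha : 0 ≤ a) (hb : 0 ≤ b) (hs : 0 ≤ s)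
    (ht : 0 ≤ t) (h : s + t = 2 * (a + b)) :
    s ^ (p / 2) + t ^ (p / 2) ≤ clarksonConst p * (a ^ (p / 2) + b ^ (p / 2)) := by
  rcases le_total p 2 with h2 | h2
  · rw [clarksonConst_of_le_two h2]
    refine (add_rpow_le_of_le_one (by positivity) (by linarith) hs ht).trans ?_
    rw [h, mul_div_cancel_left₀ _ two_ne_zero]
    gcongr
    exact Real.rpow_add_le_add_rpow ha hb (by positivity) (by linarith)
  · rw [clarksonConst_of_two_le h2]
    refine (Real.add_rpow_le_rpow_add hs ht (by linarith)).trans ?_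
    rw [h, two_mul_rpow_add (by positivity)]
    gcongr
    exact two_mul_rpow_le_of_one_le (by linarith) ha hb

lemma rpow_half_add_lt {p a b s t : ℝ} (hp : 0 ≤ p) (hp2 : p ≠ 2) (ha : 0 < a) (hb : 0 < b)
    (hs : 0 < s) (ht : 0 < t) (h : s + t = 2 * (a + b)) :
    s ^ (p / 2) + t ^ (p / 2) < clarksonConst p * (a ^ (p / 2) + b ^ (p / 2)) := by
  rcases lt_or_gt_of_ne hp2 with h2 | h2
  · rw [clarksonConst_of_le_two h2.le]
    refine (add_rpow_le_of_le_one (by positivity) (by linarith) hs.le ht.le).trans_lt ?_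
    rw [h, mul_div_cancel_left₀ _ two_ne_zero]
    gcongr
    exact lt_add_rpow (by linarith) ha hb
  · rw [clarksonConst_of_two_le h2.le]
    refine (add_rpow_lt (by linarith) hs ht).trans_le ?_
    rw [h, two_mul_rpow_add (by positivity)]
    gcongr
    exact two_mul_rpow_le_of_one_le (by linarith) ha.le hb.le

lemma min_lt_of_rpow_add_lt {p a b C : ℝ} (hp : 0 < p) (hC : 0 ≤ C)
    (h : a ^ p + b ^ p < 2 * C) : min a b < C ^ (1 / p) := by
  by_contra! hle
  have hc : (C ^ (1 / p)) ^ p = C := by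
    rw [← Real.rpow_mul hC, one_div_mul_cancel hp.ne', Real.rpow_one]
  have h1 := Real.rpow_le_rpow (by positivity) (hle.trans (min_le_left _ _)) hp.le
  have h2 := Real.rpow_le_rpow (by positivity) (hle.trans (min_le_right _ _)) hp.le
  linarith

lemma min_le_of_rpow_add_le {p a b C : ℝ} (hp : 0 < p) (hC : 0 ≤ C)
    (h : a ^ p + b ^ p ≤ 2 * C) : min a b ≤ C ^ (1 / p) := by
  by_contra! hlt
  have hc : (C ^ (1 / p)) ^ p = C := by
    rw [← Real.rpow_mul hC, one_div_mul_cancel hp.ne', Real.rpow_one]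
  have h1 := Real.rpow_lt_rpow (by positivity) (hlt.trans_le (min_le_left _ _)) hp
  have h2 := Real.rpow_lt_rpow (by positivity) (hlt.trans_le (min_le_right _ _)) hp
  linarith

/-- Two unit vectors of the plane with the `ℓ_p`-norm which attain its James constant. -/
lemma exists_extremal_pair {p : ℝ} (hp : 1 < p) : ∃ a b c d : ℝ,
    |a| ^ p + |b| ^ p = 1 ∧ |c| ^ p + |d| ^ p = 1 ∧
    |a + c| ^ p + |b + d| ^ p = clarksonConst p ∧
    |a - c| ^ p + |b - d| ^ p = clarksonConst p := by
  have hp0 : p ≠ 0 := by linarith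
  rcases le_total p 2 with h2 | h2
  · refine ⟨1, 0, 0, 1, ?_⟩
    rw [clarksonConst_of_le_two h2]
    norm_num [Real.zero_rpow hp0]
  · obtain ⟨k, hk, hkp⟩ : ∃ k : ℝ, 0 < k ∧ k ^ p = 1 / 2 :=
      ⟨(1 / 2) ^ (1 / p), by positivity, by
        rw [← Real.rpow_mul (by norm_num), one_div_mul_cancel hp0, Real.rpow_one]⟩
    refine ⟨k, k, k, -k, ?_⟩
    have h2k : (k + k) ^ p = 2 ^ (p - 1) := by
      rw [← two_mul, Real.mul_rpow two_pos.le hk.le, hkp, Real.rpow_sub_one two_ne_zero]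
      ring
    rw [clarksonConst_of_two_le h2]
    simp [abs_of_pos hk, hkp, abs_of_pos (add_pos hk hk), h2k, Real.zero_rpow hp0]
    norm_num

end RealInequalities

section InnerProductSpace

variable {H : Type*} [NormedAddCommGroup H] [InnerProductSpace ℝ H]

lemma norm_rpow_eq_sq_rpow_half {E : Type*} [SeminormedAddCommGroup E] (w : E) (p : ℝ) :
    ‖w‖ ^ p = (‖w‖ ^ 2) ^ (p / 2) := by
  rw [← Real.rpow_natCast, ← Real.rpow_mul (norm_nonneg w)]
  congr 1
  push_cast
  ring

lemma norm_add_rpow_add_norm_sub_rpow_le {p : ℝ} (hp : 0 ≤ p) (u v : H) :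
    ‖u + v‖ ^ p + ‖u - v‖ ^ p ≤ clarksonConst p * (‖u‖ ^ p + ‖v‖ ^ p) := by
  simp only [norm_rpow_eq_sq_rpow_half _ p]
  exact rpow_half_add_le hp (by positivity) (by positivity) (by positivity) (by positivity)
    (parallelogram_law_with_norm ℝ u v)

lemma norm_add_rpow_add_norm_sub_rpow_lt {p : ℝ} (hp : 0 ≤ p) (hp2 : p ≠ 2) {u v : H}
    (hu : u ≠ 0) (hv : v ≠ 0) (ha : u + v ≠ 0) (hs : u - v ≠ 0) :
    ‖u + v‖ ^ p + ‖u - v‖ ^ p < clarksonConst p * (‖u‖ ^ p + ‖v‖ ^ p) := by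
  simp only [norm_rpow_eq_sq_rpow_half _ p]
  exact rpow_half_add_lt hp hp2 (by positivity) (by positivity) (by positivity) (by positivity)
    (parallelogram_law_with_norm ℝ u v)

end InnerProductSpace

/-- The James constant is determined by an upper bound together with pairs of almost unit vectors
which almost attain it. -/
lemma jamesConstant_eq {X : Type*} [NormedAddCommGroup X] [NormedSpace ℝ X] {c : ℝ}
    (hle : ∀ x y : X, ‖x‖ = 1 → ‖y‖ = 1 → min ‖x + y‖ ‖x - y‖ ≤ c)
    (happrox : ∀ δ > 0, ∃ u v : X, 1 ≤ ‖u‖ ∧ ‖u‖ ≤ 1 + δ ∧ 1 ≤ ‖v‖ ∧ ‖v‖ ≤ 1 + δ ∧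
      c ≤ ‖u + v‖ ∧ c ≤ ‖u - v‖) :
    jamesConstant X = c := by
  have hnormalize : ∀ δ, ∀ u : X, 1 ≤ ‖u‖ → ‖u‖ ≤ 1 + δ →
      ∃ x : X, ‖x‖ = 1 ∧ ‖u - x‖ ≤ δ := by
    intro δ u h1 h2
    have hu : ‖u‖ ≠ 0 := by linarith
    refine ⟨‖u‖⁻¹ • u, by rw [norm_smul, norm_inv, norm_norm, inv_mul_cancel₀ hu], ?_⟩
    have hux : u - ‖u‖⁻¹ • u = (1 - ‖u‖⁻¹) • u := by rw [sub_smul, one_smul]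
    rw [hux, norm_smul, Real.norm_of_nonneg (sub_nonneg.2 (inv_le_one_of_one_le₀ h1)), sub_mul,
      inv_mul_cancel₀ hu]
    linarith
  have hnear : ∀ δ > 0, ∃ x y : X, ‖x‖ = 1 ∧ ‖y‖ = 1 ∧ c - 2 * δ ≤ min ‖x + y‖ ‖x - y‖ := by
    intro δ hδ
    obtain ⟨u, v, hu1, hu2, hv1, hv2, hadd, hsub⟩ := happrox δ hδ
    obtain ⟨x, hx, hux⟩ := hnormalize δ u hu1 hu2
    obtain ⟨y, hy, hvy⟩ := hnormalize δ v hv1 hv2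
    refine ⟨x, y, hx, hy, le_min ?_ ?_⟩
    · have h1 := norm_sub_norm_le (u + v) (x + y)
      have h2 := norm_add_le (u - x) (v - y)
      rw [show u - x + (v - y) = u + v - (x + y) by abel] at h2
      linarith
    · have h1 := norm_sub_norm_le (u - v) (x - y)
      have h2 := norm_sub_le (u - x) (v - y)
      rw [show u - x - (v - y) = u - v - (x - y) by abel] at h2
      linarith
  have hbdd : BddAbove {r : ℝ | ∃ x y : X, ‖x‖ = 1 ∧ ‖y‖ = 1 ∧ r = min ‖x + y‖ ‖x - y‖} :=
    ⟨c, by rintro r ⟨x, y, hx, hy, rfl⟩; exact hle x y hx hy⟩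
  refine le_antisymm (csSup_le ?_ ?_) (le_of_forall_pos_le_add fun ε hε => ?_)
  · obtain ⟨x, y, hx, hy, -⟩ := hnear 1 one_pos
    exact ⟨_, x, y, hx, hy, rfl⟩
  · rintro r ⟨x, y, hx, hy, rfl⟩
    exact hle x y hx hy
  · obtain ⟨x, y, hx, hy, h⟩ := hnear (ε / 2) (half_pos hε)
    have := le_csSup hbdd ⟨x, y, hx, hy, rfl⟩
    unfold jamesConstant
    linarith

section lp

variable {q : ℝ≥0∞}

lemma lp_norm_add_rpow_add_norm_sub_rpow_le (hq : 0 < q.toReal)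
    (x y : lp (fun _ : ℕ => ℝ) q) :
    ‖x + y‖ ^ q.toReal + ‖x - y‖ ^ q.toReal ≤
      clarksonConst q.toReal * (‖x‖ ^ q.toReal + ‖y‖ ^ q.toReal) := by
  refine hasSum_le (fun i => ?_) ((lp.hasSum_norm hq (x + y)).add (lp.hasSum_norm hq (x - y)))
    (((lp.hasSum_norm hq x).add (lp.hasSum_norm hq y)).mul_left _)
  exact norm_add_rpow_add_norm_sub_rpow_le hq.le (x i) (y i)

/-- The vector `a • e n + b • e (n + 1)` of `ℓ_p`. -/
noncomputable def lpPair (q : ℝ≥0∞) (n : ℕ) (a b : ℝ) : lp (fun _ : ℕ => ℝ) q :=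
  lp.single q n a + lp.single q (n + 1) b

lemma lpPair_add (n : ℕ) (a b c d : ℝ) :
    lpPair q n a b + lpPair q n c d = lpPair q n (a + c) (b + d) := by
  simp only [lpPair, lp.single_add]
  abel

lemma lpPair_sub (n : ℕ) (a b c d : ℝ) :
    lpPair q n a b - lpPair q n c d = lpPair q n (a - c) (b - d) := by
  simp only [lpPair, lp.single_sub]
  abel

lemma norm_lpPair (hq : 0 < q.toReal) (n : ℕ) (a b : ℝ) :
    ‖lpPair q n a b‖ = (|a| ^ q.toReal + |b| ^ q.toReal) ^ (1 / q.toReal) := by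
  have h := lp.norm_sum_single (E := fun _ : ℕ => ℝ) hq (fun i => if i = n then a else b)
    {n, n + 1}
  have hn : n ≠ n + 1 := by simp
  rw [Finset.sum_pair hn, Finset.sum_pair hn] at h
  simp only [if_true, if_neg hn.symm, Real.norm_eq_abs] at h
  rw [← h, lpPair, one_div, Real.rpow_rpow_inv (lp.norm_nonneg' _) hq.ne']

variable [Fact (1 ≤ q)]

lemma ne_zero_of_fact_one_le (q : ℝ≥0∞) [h : Fact (1 ≤ q)] : q ≠ 0 :=
  (zero_lt_one.trans_le h.out).ne'

lemma memℓp_half_pow : Memℓp (fun n : ℕ => (1 / 2 : ℝ) ^ n) 2 := by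
  refine memℓp_gen ?_
  have : (fun n : ℕ => ‖(1 / 2 : ℝ) ^ n‖ ^ (2 : ℝ≥0∞).toReal) = fun n : ℕ => (1 / 4 : ℝ) ^ n := by
    ext n
    rw [ENNReal.toReal_ofNat, Real.rpow_ofNat, Real.norm_of_nonneg (by positivity), ← pow_mul,
      mul_comm, pow_mul]
    norm_num
  rw [this]
  exact summable_geometric_of_lt_one (by norm_num) (by norm_num)

lemma norm_half_pow_mul_le (x : lp (fun _ : ℕ => ℝ) q) (n : ℕ) :
    ‖(1 / 2 : ℝ) ^ n * x n‖ ≤ ‖(‖x‖ • fun n : ℕ => (1 / 2 : ℝ) ^ n) n‖ := by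
  rw [Pi.smul_apply, norm_mul, norm_smul, norm_norm, mul_comm]
  gcongr
  exact lp.norm_apply_le_norm (ne_zero_of_fact_one_le q) x n

/-- The injective operator `x ↦ (2⁻ⁿ xₙ)ₙ` from `ℓ_p` to `ℓ_2`. -/
noncomputable def weightedEmbedding (q : ℝ≥0∞) [Fact (1 ≤ q)] :
    lp (fun _ : ℕ => ℝ) q →L[ℝ] lp (fun _ : ℕ => ℝ) 2 :=
  LinearMap.mkContinuous
    { toFun := fun x => ⟨fun n => (1 / 2 : ℝ) ^ n * x n,
        (memℓp_half_pow.const_smul ‖x‖).mono' (norm_half_pow_mul_le x)⟩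
      map_add' := fun x y => lp.ext (funext fun n => mul_add _ (x n) (y n))
      map_smul' := fun c x => lp.ext (funext fun n => mul_left_comm _ c (x n)) }
    ‖(⟨_, memℓp_half_pow⟩ : lp (fun _ : ℕ => ℝ) 2)‖ fun x => by
      rw [mul_comm, ← norm_norm x, ← norm_smul]
      exact lp.norm_mono two_ne_zero (norm_half_pow_mul_le x)

lemma weightedEmbedding_apply (x : lp (fun _ : ℕ => ℝ) q) (n : ℕ) :
    weightedEmbedding q x n = (1 / 2 : ℝ) ^ n * x n := rfl

lemma weightedEmbedding_injective : Function.Injective (weightedEmbedding q) := by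
  intro x y h
  refine lp.ext (funext fun n => ?_)
  have hn : weightedEmbedding q x n = weightedEmbedding q y n := by rw [h]
  exact mul_left_cancel₀ (by positivity) hn

lemma weightedEmbedding_ne_zero {x : lp (fun _ : ℕ => ℝ) q} (hx : x ≠ 0) :
    weightedEmbedding q x ≠ 0 :=
  (map_ne_zero_iff _ weightedEmbedding_injective).2 hx

lemma weightedEmbedding_single (n : ℕ) (a : ℝ) :
    weightedEmbedding q (lp.single q n a) = lp.single 2 n ((1 / 2 : ℝ) ^ n * a) := by
  refine lp.ext (funext fun m => ?_)
  rw [weightedEmbedding_apply, lp.single_apply, lp.single_apply]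
  rcases eq_or_ne m n with rfl | h
  · simp
  · simp [Pi.single_eq_of_ne h]

lemma norm_weightedEmbedding_lpPair_le (n : ℕ) (a b : ℝ) :
    ‖weightedEmbedding q (lpPair q n a b)‖ ≤ (1 / 2) ^ n * (|a| + |b|) := by
  rw [lpPair, map_add, weightedEmbedding_single, weightedEmbedding_single]
  refine (norm_add_le _ _).trans ?_
  rw [lp.norm_single two_pos, lp.norm_single two_pos, norm_mul, norm_mul, mul_add]
  simp only [norm_pow, Real.norm_eq_abs, abs_of_pos (one_half_pos : (0 : ℝ) < 1 / 2)]
  have h : (1 / 2 : ℝ) ^ (n + 1) ≤ (1 / 2) ^ n :=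
    pow_le_pow_of_le_one (by norm_num) (by norm_num) n.le_succ
  gcongr

/-- The graph embedding `x ↦ (x, weightedEmbedding q x)` into the `p`-sum of `ℓ_p` and `ℓ_2`. -/
noncomputable def graphEmbedding (q : ℝ≥0∞) [Fact (1 ≤ q)] :
    lp (fun _ : ℕ => ℝ) q →L[ℝ]
      WithLp q (lp (fun _ : ℕ => ℝ) q × lp (fun _ : ℕ => ℝ) 2) :=
  (WithLp.prodContinuousLinearEquiv q ℝ _ _).symm.toContinuousLinearMap ∘L
    (ContinuousLinearMap.id ℝ _).prod (weightedEmbedding q)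

lemma norm_graphEmbedding_rpow (hq : 0 < q.toReal) (x : lp (fun _ : ℕ => ℝ) q) :
    ‖graphEmbedding q x‖ ^ q.toReal =
      ‖x‖ ^ q.toReal + ‖weightedEmbedding q x‖ ^ q.toReal := by
  rw [WithLp.prod_norm_eq_add hq, one_div, Real.rpow_inv_rpow (by positivity) hq.ne']
  rfl

lemma norm_le_norm_graphEmbedding (hq : 0 < q.toReal) (x : lp (fun _ : ℕ => ℝ) q) :
    ‖x‖ ≤ ‖graphEmbedding q x‖ := by
  rw [← Real.rpow_le_rpow_iff (norm_nonneg _) (norm_nonneg _) hq, norm_graphEmbedding_rpow hq]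
  exact le_add_of_nonneg_right (by positivity)

lemma norm_graphEmbedding_le (hq : 1 ≤ q.toReal) (x : lp (fun _ : ℕ => ℝ) q) :
    ‖graphEmbedding q x‖ ≤ ‖x‖ + ‖weightedEmbedding q x‖ := by
  have hq0 : 0 < q.toReal := by linarith
  rw [← Real.rpow_le_rpow_iff (norm_nonneg _) (by positivity) hq0, norm_graphEmbedding_rpow hq0]
  exact Real.add_rpow_le_rpow_add (norm_nonneg _) (norm_nonneg _) hq

lemma isClosed_range_graphEmbedding (hq : 0 < q.toReal) :
    IsClosed (Set.range (graphEmbedding q)) :=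
  (AddMonoidHomClass.antilipschitz_of_bound (K := 1) (graphEmbedding q) fun x => by
    simpa using norm_le_norm_graphEmbedding hq x).isClosed_range
      (graphEmbedding q).uniformContinuous

lemma graphEmbedding_injective (hq : 0 < q.toReal) : Function.Injective (graphEmbedding q) :=
  (injective_iff_map_eq_zero _).2 fun x hx => norm_le_zero_iff.1 <| by
    simpa [hx] using norm_le_norm_graphEmbedding hq x

lemma norm_graphEmbedding_add_rpow_add_sub_rpow_lt (hq : 0 < q.toReal) (hq2 : q.toReal ≠ 2)
    {x y : lp (fun _ : ℕ => ℝ) q} (hx : x ≠ 0) (hy : y ≠ 0) (ha : x + y ≠ 0) (hs : x - y ≠ 0) :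
    ‖graphEmbedding q (x + y)‖ ^ q.toReal + ‖graphEmbedding q (x - y)‖ ^ q.toReal <
      clarksonConst q.toReal *
        (‖graphEmbedding q x‖ ^ q.toReal + ‖graphEmbedding q y‖ ^ q.toReal) := by
  have h1 := lp_norm_add_rpow_add_norm_sub_rpow_le hq x y
  have h2 := norm_add_rpow_add_norm_sub_rpow_lt hq.le hq2
    (weightedEmbedding_ne_zero hx) (weightedEmbedding_ne_zero hy)
    (by rw [← map_add]; exact weightedEmbedding_ne_zero ha)
    (by rw [← map_sub]; exact weightedEmbedding_ne_zero hs)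
  rw [← map_add, ← map_sub] at h2
  simp only [norm_graphEmbedding_rpow hq]
  linarith

lemma min_norm_graphEmbedding_lt (hq : 0 < q.toReal) (hq2 : q.toReal ≠ 2)
    {x y : lp (fun _ : ℕ => ℝ) q} (hx : ‖graphEmbedding q x‖ = 1)
    (hy : ‖graphEmbedding q y‖ = 1) :
    min ‖graphEmbedding q (x + y)‖ ‖graphEmbedding q (x - y)‖ <
      clarksonConst q.toReal ^ (1 / q.toReal) := by
  have hC : 0 < clarksonConst q.toReal ^ (1 / q.toReal) :=
    Real.rpow_pos_of_pos (clarksonConst_pos _) _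
  by_cases ha : x + y = 0
  · exact (min_le_left _ _).trans_lt (by simpa [ha] using hC)
  by_cases hs : x - y = 0
  · exact (min_le_right _ _).trans_lt (by simpa [hs] using hC)
  have h := norm_graphEmbedding_add_rpow_add_sub_rpow_lt hq hq2
    (x := x) (y := y) (by rintro rfl; simp at hx) (by rintro rfl; simp at hy) ha hs
  refine min_lt_of_rpow_add_lt hq (clarksonConst_pos _).le ?_
  rw [hx, hy, Real.one_rpow] at h
  linarith

lemma jamesConstant_lp (hq : 1 < q.toReal) :
    jamesConstant (lp (fun _ : ℕ => ℝ) q) = clarksonConst q.toReal ^ (1 / q.toReal) := by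
  have hq0 : 0 < q.toReal := by linarith
  refine jamesConstant_eq (fun x y hx hy => ?_) fun δ hδ => ?_
  · refine min_le_of_rpow_add_le hq0 (clarksonConst_pos _).le ?_
    have h := lp_norm_add_rpow_add_norm_sub_rpow_le hq0 x y
    rw [hx, hy, Real.one_rpow] at h
    linarith
  · obtain ⟨a, b, c, d, h1, h2, h3, h4⟩ := exists_extremal_pair hq
    refine ⟨lpPair q 0 a b, lpPair q 0 c d, ?_⟩
    rw [lpPair_add, lpPair_sub]
    simp only [norm_lpPair hq0, h1, h2, h3, h4, Real.one_rpow]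
    exact ⟨le_rfl, by linarith, le_rfl, by linarith, le_rfl, le_rfl⟩

lemma jamesConstant_range_graphEmbedding (hq : 1 < q.toReal) (hq2 : q.toReal ≠ 2) :
    jamesConstant (graphEmbedding q).range =
      clarksonConst q.toReal ^ (1 / q.toReal) := by
  have hq0 : 0 < q.toReal := by linarith
  refine jamesConstant_eq ?_ fun δ hδ => ?_
  · rintro ⟨_, x, rfl⟩ ⟨_, y, rfl⟩ hx hy
    have h := min_norm_graphEmbedding_lt hq0 hq2 (x := x) (y := y) hx hy
    rw [map_add, map_sub] at h
    exact h.le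
  · obtain ⟨a, b, c, d, h1, h2, h3, h4⟩ := exists_extremal_pair hq
    obtain ⟨n, hn⟩ : ∃ n : ℕ, (1 / 2 : ℝ) ^ n * (|a| + |b| + |c| + |d|) < δ := by
      have := (tendsto_pow_atTop_nhds_zero_of_lt_one (r := (1 / 2 : ℝ)) (by norm_num)
        (by norm_num)).mul_const (|a| + |b| + |c| + |d|)
      rw [zero_mul] at this
      exact (this.eventually_lt_const hδ).exists
    have hpos : (0 : ℝ) < (1 / 2) ^ n := by positivity
    have hu := norm_weightedEmbedding_lpPair_le (q := q) n a b
    have hv := norm_weightedEmbedding_lpPair_le (q := q) n c d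
    have hu1 : ‖lpPair q n a b‖ = 1 := by rw [norm_lpPair hq0, h1, Real.one_rpow]
    have hv1 : ‖lpPair q n c d‖ = 1 := by rw [norm_lpPair hq0, h2, Real.one_rpow]
    have hab : (1 / 2 : ℝ) ^ n * (|a| + |b|) ≤ (1 / 2) ^ n * (|a| + |b| + |c| + |d|) :=
      mul_le_mul_of_nonneg_left (by linarith [abs_nonneg c, abs_nonneg d]) hpos.le
    have hcd : (1 / 2 : ℝ) ^ n * (|c| + |d|) ≤ (1 / 2) ^ n * (|a| + |b| + |c| + |d|) :=
      mul_le_mul_of_nonneg_left (by linarith [abs_nonneg a, abs_nonneg b]) hpos.le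
    have hadd := norm_le_norm_graphEmbedding hq0 (lpPair q n a b + lpPair q n c d)
    have hsub := norm_le_norm_graphEmbedding hq0 (lpPair q n a b - lpPair q n c d)
    rw [lpPair_add, norm_lpPair hq0, h3, ← lpPair_add, map_add] at hadd
    rw [lpPair_sub, norm_lpPair hq0, h4, ← lpPair_sub, map_sub] at hsub
    refine ⟨⟨graphEmbedding q (lpPair q n a b), _, rfl⟩,
      ⟨graphEmbedding q (lpPair q n c d), _, rfl⟩, ?_, ?_, ?_, ?_, hadd, hsub⟩
    · exact hu1.ge.trans (norm_le_norm_graphEmbedding hq0 _)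
    · exact (norm_graphEmbedding_le hq.le _).trans (by linarith)
    · exact hv1.ge.trans (norm_le_norm_graphEmbedding hq0 _)
    · exact (norm_graphEmbedding_le hq.le _).trans (by linarith)

lemma exists_equiv_lp_jamesConstant_not_attained (hq : 1 < q.toReal) (hq2 : q.toReal ≠ 2) :
    ∃ (X : Type) (_ : NormedAddCommGroup X) (_ : NormedSpace ℝ X) (_ : CompleteSpace X),
      Nonempty (lp (fun _ : ℕ => ℝ) q ≃L[ℝ] X) ∧
      jamesConstant X = jamesConstant (lp (fun _ : ℕ => ℝ) q) ∧
      ∀ x y : X, ‖x‖ = 1 → ‖y‖ = 1 → min ‖x + y‖ ‖x - y‖ < jamesConstant X := by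
  have hq0 : 0 < q.toReal := by linarith
  have hclosed := isClosed_range_graphEmbedding hq0
  refine ⟨(graphEmbedding q).range, inferInstance, inferInstance, hclosed.completeSpace_coe,
    ⟨(graphEmbedding q).equivRange (graphEmbedding_injective hq0) hclosed⟩, ?_, ?_⟩
  · rw [jamesConstant_lp hq]
    exact jamesConstant_range_graphEmbedding hq hq2
  · rw [jamesConstant_range_graphEmbedding hq hq2]
    rintro ⟨_, x, rfl⟩ ⟨_, y, rfl⟩ hx hy
    have h := min_norm_graphEmbedding_lt hq0 hq2 (x := x) (y := y) hx hy
    rw [map_add, map_sub] at h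
    exact h

end lp

/-- For each `p ∈ (1, ∞)`, `p ≠ 2`, there is a Banach space `X` isomorphic to `ℓ_p` with
`J(X) = J(ℓ_p)` such that the supremum in the definition of the James constant of `X`
is not attained. -/
theorem exists_james_constant_not_attained (p : ℝ) (hp1 : 1 < p) (hp2 : p ≠ 2) :
    haveI : Fact ((1 : ℝ≥0∞) ≤ ENNReal.ofReal p) := ⟨ENNReal.one_le_ofReal.mpr hp1.le⟩
    ∃ (X : Type) (_ : NormedAddCommGroup X) (_ : NormedSpace ℝ X) (_ : CompleteSpace X),
      Nonempty (lp (fun _ : ℕ => ℝ) (ENNReal.ofReal p) ≃L[ℝ] X) ∧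
      jamesConstant X = jamesConstant (lp (fun _ : ℕ => ℝ) (ENNReal.ofReal p)) ∧
      ∀ x y : X, ‖x‖ = 1 → ‖y‖ = 1 → min ‖x + y‖ ‖x - y‖ < jamesConstant X := by
  have hp : (ENNReal.ofReal p).toReal = p := ENNReal.toReal_ofReal (by linarith)
  have : Fact ((1 : ℝ≥0∞) ≤ ENNReal.ofReal p) := ⟨ENNReal.one_le_ofReal.mpr hp1.le⟩
  exact exists_equiv_lp_jamesConstant_not_attained (hp.symm ▸ hp1) (hp.symm ▸ hp2)
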